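/- Let I and X be disjoint sets of edges of the complete graph on V, let v ∈ V, let T be a 1-tree rooted at v of minimum weight among those whose edge set contains every edge of I and no edge of X, and let H be any Hamiltonian cycle on V whose edge set contains every edge of I and no edge of X. Then the sum of the weights of the edges of T that are not in I is at most the sum of the weights of the edges of H that are not in I. -/

import Mathlib

open SimpleGraph Finset

variable {V : Type} [Fintype V] [DecidableEq V]

/-- `S` is the edge set of a spanning tree of the complete graph on `V \ {v}`:
the edges of a tree on the subtype `{u // u ≠ v}`, viewed inside `Sym2 V`. -/
def IsSpanningTreeOff (v : V) (S : Finset (Sym2 V)) : Prop :=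
  ∃ T : SimpleGraph {u : V // u ≠ v}, T.IsTree ∧
    (S : Set (Sym2 V)) = Sym2.map Subtype.val '' T.edgeSet

/-- `T` is (the edge set of) a 1-tree rooted at `v`: a spanning tree of the complete
graph on `V \ {v}` together with two distinct (non-loop) edges incident with `v`. -/
def IsOneTree (v : V) (T : Finset (Sym2 V)) : Prop :=
  ∃ (S : Finset (Sym2 V)) (e₁ e₂ : Sym2 V),
    IsSpanningTreeOff v S ∧ e₁ ≠ e₂ ∧ v ∈ e₁ ∧ v ∈ e₂ ∧
    ¬ e₁.IsDiag ∧ ¬ e₂.IsDiag ∧ T = S ∪ {e₁, e₂}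

/-- The total weight of an edge set. -/
noncomputable def weight (w : Sym2 V → ℝ) (T : Finset (Sym2 V)) : ℝ := ∑ e ∈ T, w e

theorem SimpleGraph.Walk.edgeSet_fromEdgeSet_edges {W : Type*} {G : SimpleGraph W} {a b : W}
    (p : G.Walk a b) : (fromEdgeSet {e | e ∈ p.edges}).edgeSet = {e | e ∈ p.edges} := by
  rw [edgeSet_fromEdgeSet]
  exact sdiff_eq_left.2 (Set.disjoint_left.2 fun e he hd ↦
    G.not_isDiag_of_mem_edgeSet (p.edges_subset_edgeSet he) hd)

/-- The edges traversed by a Hamiltonian path form a spanning tree. -/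
theorem SimpleGraph.Walk.IsHamiltonian.isTree_fromEdgeSet {W : Type*} [Fintype W] [DecidableEq W]
    {G : SimpleGraph W} {a b : W} {p : G.Walk a b} (hp : p.IsHamiltonian) :
    (fromEdgeSet {e | e ∈ p.edges}).IsTree := by
  have hedge := p.edgeSet_fromEdgeSet_edges
  rw [isTree_iff_connected_and_card]
  constructor
  · rw [connected_iff_exists_forall_reachable]
    refine ⟨a, fun c ↦ ?_⟩
    let q := p.transfer (fromEdgeSet {e | e ∈ p.edges}) fun e he ↦ by rwa [hedge]
    have hc : c ∈ q.support := by simp [q, hp.mem_support c]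
    exact ⟨q.takeUntil c hc⟩
  · have : {e | e ∈ p.edges} = (p.edges.toFinset : Set (Sym2 W)) := by ext; simp
    rw [hedge, this, Nat.card_coe_set_eq, Set.ncard_coe_finset,
      List.toFinset_card_of_nodup hp.isPath.isTrail.edges_nodup, length_edges, hp.length_eq,
      Nat.card_eq_fintype_card]
    have : 0 < Fintype.card W := Fintype.card_pos_iff.2 ⟨a⟩
    omega

/-- A path visiting every vertex except `v` traverses a spanning tree off `v`. -/
theorem isSpanningTreeOff_edges {G : SimpleGraph V} {v a b : V} {q : G.Walk a b} (hq : q.IsPath)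
    (hmem : ∀ c, c ∈ q.support ↔ c ≠ v) : IsSpanningTreeOff v q.edges.toFinset := by
  let q' := q.induce {c | c ≠ v} fun c hc ↦ (hmem c).1 hc
  have hmap : q'.map (Embedding.induce {c | c ≠ v}).toHom = q := q.map_induce _
  have hpath : q'.IsPath := .of_map (f := (Embedding.induce {c | c ≠ v}).toHom) (by rwa [hmap])
  have hq' : q'.IsHamiltonian := hpath.isHamiltonian_of_mem fun c ↦ by
    simpa [q'] using (hmem c).2 c.2
  refine ⟨_, hq'.isTree_fromEdgeSet, ?_⟩
  refine Eq.trans ?_ (congrArg (Sym2.map Subtype.val '' ·) q'.edgeSet_fromEdgeSet_edges).symm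
  have hedges : q.edges = q'.edges.map (Sym2.map Subtype.val) :=
    (congrArg Walk.edges hmap.symm).trans (Walk.edges_map _ q')
  rw [hedges]
  ext e
  simp only [List.coe_toFinset, List.mem_map, Set.mem_ofPred_eq]
  rfl

/-- The edge set of a Hamiltonian cycle is a 1-tree rooted at any vertex. -/
theorem SimpleGraph.Walk.IsHamiltonianCycle.isOneTree {G : SimpleGraph V} {r : V}
    {H : G.Walk r r} (hH : H.IsHamiltonianCycle) (v : V) : IsOneTree v H.edges.toFinset := by
  have hv := hH.mem_support v
  rw [← List.toFinset_eq_of_perm _ _ (H.rotate_edges v hv).perm]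
  have hC : (H.rotate v hv).IsHamiltonianCycle := (isHamiltonianCycle_rotate hv).2 hH
  generalize H.rotate v hv = C at hC
  cases C with
  | nil => exact absurd rfl hC.ne_nil
  | cons h p =>
    rename_i u
    obtain ⟨hp, hnot⟩ := (cons_isCycle_iff p h).1 hC.isCycle
    have hnil : ¬ p.Nil := fun hn ↦ h.ne hn.eq.symm
    have hadj := p.adj_penultimate hnil
    have hconcat := p.concat_dropLast hadj
    generalize p.dropLast = q at hconcat
    generalize p.penultimate = x at *
    subst hconcat
    have hnodup := hp.support_nodup
    rw [support_concat, List.nodup_append] at hnodup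
    have hvq : v ∉ q.support := fun hc ↦ hnodup.2.2 v hc v (by simp) rfl
    refine ⟨q.edges.toFinset, s(v, u), s(x, v),
      isSpanningTreeOff_edges (.mk' hnodup.1) fun c ↦ ?_, ?_, by simp, by simp, by simpa using h.ne,
      by simpa using hadj.ne, ?_⟩
    · refine ⟨fun hc hcv ↦ hvq (hcv ▸ hc), fun hc ↦ ?_⟩
      have := hC.mem_support c
      simpa [support_concat, hc] using this
    · exact fun heq ↦ hnot (by simp [edges_concat, heq])
    · ext e
      simp [edges_concat]

theorem stmt7 {V : Type} [Fintype V] [DecidableEq V] (h3 : 3 ≤ Fintype.card V)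
    (w : Sym2 V → ℝ) (I X : Finset (Sym2 V))
    (hIedge : (I : Set (Sym2 V)) ⊆ (⊤ : SimpleGraph V).edgeSet)
    (hXedge : (X : Set (Sym2 V)) ⊆ (⊤ : SimpleGraph V).edgeSet)
    (hIX : Disjoint I X) (v : V)
    (T : Finset (Sym2 V)) (hT : IsOneTree v T) (hTI : I ⊆ T) (hTX : ∀ e ∈ X, e ∉ T)
    (hmin : ∀ T' : Finset (Sym2 V), IsOneTree v T' → I ⊆ T' → (∀ e ∈ X, e ∉ T') →
      weight w T ≤ weight w T')
    (r : V) (H : (⊤ : SimpleGraph V).Walk r r) (hH : H.IsHamiltonianCycle)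
    (hIH : I ⊆ H.edges.toFinset) (hXH : ∀ e ∈ X, e ∉ H.edges.toFinset) :
    weight w (T \ I) ≤ weight w (H.edges.toFinset \ I) := by
  have hle := hmin _ (hH.isOneTree v) hIH hXH
  have hT' := Finset.sum_sdiff (f := w) hTI
  have hH' := Finset.sum_sdiff (f := w) hIH
  unfold weight at *
  linarith
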